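/- Let k = 2d for an integer d ≥ 2, let n ≥ 1 be an integer, and let p : ℕ → ℕ be any function. There exists ε₀ > 0 such that for every ε ∈ (0, ε₀): the partition C of X(n,ε,d) into the 2d ε-balls has k-center cost ε; this is the optimal k-center cost of X(n,ε,d) over all partitions into at most k clusters; and every partition of X(n,ε,d) into at most k clusters other than C has k-center cost at least p(4nd²) times the k-center cost of C. -/

import Mathlib

noncomputable section

attribute [local instance] Classical.propDecidable

/-- A threshold decision tree over `ℝ^d`: every internal node is labeled by a
coordinate index and a real threshold. -/
inductive TDT (d : ℕ) : Type
  | leaf : TDT d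
  | node (r : Fin d) (θ : ℝ) (left right : TDT d) : TDT d

namespace TDT

/-- The number of leaves of a threshold decision tree. -/
def leaves {d : ℕ} : TDT d → ℕ
  | leaf => 1
  | node _ _ l r => l.leaves + r.leaves

/-- The depth of a threshold decision tree: the maximum number of internal nodes
on a root-to-leaf path. -/
def depth {d : ℕ} : TDT d → ℕ
  | leaf => 0
  | node _ _ l r => max l.depth r.depth + 1

/-- The index (numbering leaves from left to right) of the leaf a point is routed to:
at a node labeled `(r, θ)` the point goes left when its `r`-th coordinate is `< θ`,
and right otherwise. -/
def route {d : ℕ} : TDT d → EuclideanSpace ℝ (Fin d) → ℕ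
  | leaf, _ => 0
  | node r θ l rt, x => if x r < θ then l.route x else l.leaves + rt.route x

/-- The clustering of a finite multiset induced by a threshold decision tree:
the partition of `X` into the nonempty fibers of `route` (points routed to the
same leaf form one cluster). -/
def clustering {d : ℕ} (t : TDT d) (X : Multiset (EuclideanSpace ℝ (Fin d))) :
    Multiset (Multiset (EuclideanSpace ℝ (Fin d))) :=
  Multiset.filter (fun C => C ≠ 0)
    ((Finset.range t.leaves).val.map fun i => X.filter fun x => t.route x = i)

end TDT

/-- `P` is a partition of the multiset `X` into at most `k` nonempty clusters. -/
def IsClustering {d : ℕ} (X : Multiset (EuclideanSpace ℝ (Fin d))) (k : ℕ)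
    (P : Multiset (Multiset (EuclideanSpace ℝ (Fin d)))) : Prop :=
  P.sum = X ∧ Multiset.card P ≤ k ∧ (0 : Multiset (EuclideanSpace ℝ (Fin d))) ∉ P

/-- The `1`-means cost of a single cluster: `inf_c Σ_{x ∈ C} ‖x - c‖²`. -/
def costMeans1 {d : ℕ} (C : Multiset (EuclideanSpace ℝ (Fin d))) : ℝ :=
  ⨅ c : EuclideanSpace ℝ (Fin d), (C.map fun x => ‖x - c‖ ^ 2).sum

/-- The k-means cost of a partition. -/
def costMeans {d : ℕ} (P : Multiset (Multiset (EuclideanSpace ℝ (Fin d)))) : ℝ :=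
  (P.map costMeans1).sum

/-- The `1`-median cost of a single cluster: `inf_c Σ_{x ∈ C} ‖x - c‖`. -/
def costMedian1 {d : ℕ} (C : Multiset (EuclideanSpace ℝ (Fin d))) : ℝ :=
  ⨅ c : EuclideanSpace ℝ (Fin d), (C.map fun x => ‖x - c‖).sum

/-- The k-median cost of a partition. -/
def costMedian {d : ℕ} (P : Multiset (Multiset (EuclideanSpace ℝ (Fin d)))) : ℝ :=
  (P.map costMedian1).sum

/-- The `1`-center cost of a single cluster: `inf_c max_{x ∈ C} ‖x - c‖`. -/
def costCenter1 {d : ℕ} (C : Multiset (EuclideanSpace ℝ (Fin d))) : ℝ :=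
  ⨅ c : EuclideanSpace ℝ (Fin d), sSup ((fun x => ‖x - c‖) '' {x | x ∈ C})

/-- The k-center cost of a partition: the maximum over clusters of the `1`-center cost. -/
def costCenter {d : ℕ} (P : Multiset (Multiset (EuclideanSpace ℝ (Fin d)))) : ℝ :=
  sSup (costCenter1 '' {C | C ∈ P})

/-- The optimal k-means cost of `X` over all partitions into at most `k` clusters. -/
def optMeans {d : ℕ} (X : Multiset (EuclideanSpace ℝ (Fin d))) (k : ℕ) : ℝ :=
  sInf {r : ℝ | ∃ P, IsClustering X k P ∧ r = costMeans P}

/-- The optimal k-median cost of `X` over all partitions into at most `k` clusters. -/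
def optMedian {d : ℕ} (X : Multiset (EuclideanSpace ℝ (Fin d))) (k : ℕ) : ℝ :=
  sInf {r : ℝ | ∃ P, IsClustering X k P ∧ r = costMedian P}

/-- The optimal k-center cost of `X` over all partitions into at most `k` clusters. -/
def optCenter {d : ℕ} (X : Multiset (EuclideanSpace ℝ (Fin d))) (k : ℕ) : ℝ :=
  sInf {r : ℝ | ∃ P, IsClustering X k P ∧ r = costCenter P}

/-! ### The high-dimensional point-set `X(n, ε, d)` -/

/-- The sign `1` or `-1` encoded by a boolean. -/
def sgn (b : Bool) : ℝ := if b then 1 else -1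

/-- The point `a·e_i + ε·b·e_j` (with signs `a, b` encoded by booleans). -/
def hdPoint (d : ℕ) (ε : ℝ) (i j : Fin d) (a b : Bool) : EuclideanSpace ℝ (Fin d) :=
  EuclideanSpace.single i (sgn a) + EuclideanSpace.single j (ε * sgn b)

/-- The ε-ball `B_i^a`: `n` copies of `a·e_i + ε·b·e_j` for all `j` and signs `b`. -/
def epsBall (n d : ℕ) (ε : ℝ) (i : Fin d) (a : Bool) : Multiset (EuclideanSpace ℝ (Fin d)) :=
  (Finset.univ : Finset (Fin d × Bool)).val.bind fun jb =>
    Multiset.replicate n (hdPoint d ε i jb.1 a jb.2)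

/-- The partition `C` of `X(n, ε, d)` into the `2d` ε-balls `B_i^a`. -/
def XhdPartition (n d : ℕ) (ε : ℝ) : Multiset (Multiset (EuclideanSpace ℝ (Fin d))) :=
  (Finset.univ : Finset (Fin d × Bool)).val.map fun ia => epsBall n d ε ia.1 ia.2

/-- The multiset `X(n, ε, d)`: `n` copies of `a·e_i + ε·b·e_j` for all `i, j ∈ [d]`,
`a, b ∈ {1, -1}`; it has `4nd²` points counted with multiplicity. -/
def Xhd (n d : ℕ) (ε : ℝ) : Multiset (EuclideanSpace ℝ (Fin d)) :=
  (XhdPartition n d ε).sum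

/-! ### The weighted planar point-set `X(w, h)` -/

/-- A pair of reals viewed as a point of the Euclidean plane. -/
def toE2 (q : ℝ × ℝ) : EuclideanSpace ℝ (Fin 2) :=
  (WithLp.equiv 2 (Fin 2 → ℝ)).symm ![q.1, q.2]

/-- `planarP h i = (p_i^1, p_i^2)`, the two points of the `i`-th cluster of the
weighted planar point-set `X(w, h)` (positions depend only on `h`). -/
def planarP (h : ℕ → ℝ) : ℕ → (ℝ × ℝ) × (ℝ × ℝ)
  | 0 => ((0, 0), (0, 0))
  | 1 => ((0, 0), (0, 0))
  | 2 => ((h 2, 0), (h 2, 0))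
  | i + 3 =>
      let q := planarP h (i + 1)
      let q' := planarP h (i + 2)
      if (i + 3) % 2 = 1 then
        ((q.1.1 - 1, q.1.2 + h (i + 3)), (q'.2.1 + 1, q.2.2 + h (i + 3)))
      else
        ((q.1.1 + h (i + 3), q.1.2 - 1), (q.2.1 + h (i + 3), q'.2.2 + 1))

/-- The position of the weighted point indexed by `(i, a) : Fin k × Fin 2`,
i.e. `p_{i+1}^{a+1}`. -/
def wpt (k : ℕ) (h : ℕ → ℝ) (x : Fin k × Fin 2) : EuclideanSpace ℝ (Fin 2) :=
  toE2 (if x.2 = (0 : Fin 2) then (planarP h ((x.1 : ℕ) + 1)).1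
        else (planarP h ((x.1 : ℕ) + 1)).2)

/-- `P` is a partition of the index set of the `2k` weighted points into at most `k`
nonempty clusters. -/
def IsIdxPartition (k : ℕ) (P : Finset (Finset (Fin k × Fin 2))) : Prop :=
  P.card ≤ k ∧ (∀ S ∈ P, S.Nonempty) ∧
    ∀ x : Fin k × Fin 2, ∃! S : Finset (Fin k × Fin 2), S ∈ P ∧ x ∈ S

/-- The weighted k-means cost of a partition of the index set of `X(w, h)`. -/
def wCostMeans (k : ℕ) (h w : ℕ → ℝ) (P : Finset (Finset (Fin k × Fin 2))) : ℝ :=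
  ∑ S ∈ P, ⨅ c : EuclideanSpace ℝ (Fin 2),
    ∑ x ∈ S, w ((x.1 : ℕ) + 1) * ‖wpt k h x - c‖ ^ 2

/-- The weighted k-median cost of a partition of the index set of `X(w, h)`. -/
def wCostMedian (k : ℕ) (h w : ℕ → ℝ) (P : Finset (Finset (Fin k × Fin 2))) : ℝ :=
  ∑ S ∈ P, ⨅ c : EuclideanSpace ℝ (Fin 2),
    ∑ x ∈ S, w ((x.1 : ℕ) + 1) * ‖wpt k h x - c‖

/-- The minimum weighted k-means cost over all partitions of the `2k` weighted points
into at most `k` clusters. -/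
def wOptMeans (k : ℕ) (h w : ℕ → ℝ) : ℝ :=
  sInf {r : ℝ | ∃ P, IsIdxPartition k P ∧ r = wCostMeans k h w P}

/-- The minimum weighted k-median cost over all partitions of the `2k` weighted points
into at most `k` clusters. -/
def wOptMedian (k : ℕ) (h w : ℕ → ℝ) : ℝ :=
  sInf {r : ℝ | ∃ P, IsIdxPartition k P ∧ r = wCostMedian k h w P}

/-- The canonical partition `C = (C_1, …, C_k)` of the index set, where
`C_i = {p_i^1, p_i^2}`. -/
def wCanonical (k : ℕ) : Finset (Finset (Fin k × Fin 2)) :=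
  (Finset.univ : Finset (Fin k)).image fun i =>
    Finset.univ.filter fun x : Fin k × Fin 2 => x.1 = i

/-- The partition of the index set of the `2k` weighted points induced by a threshold
decision tree (nonempty fibers of the routing of the corresponding positions). -/
def treeIdxPartition (k : ℕ) (t : TDT 2) (h : ℕ → ℝ) : Finset (Finset (Fin k × Fin 2)) :=
  Finset.filter (fun S => S.Nonempty)
    ((Finset.range t.leaves).image fun ℓ =>
      Finset.univ.filter fun x : Fin k × Fin 2 => t.route (wpt k h x) = ℓ)

/-! ### The planar point-set `Y_k` for k-center -/

/-- The four points of the first cluster of `Y_k`. -/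
def Ybase1 : Fin 4 → ℝ × ℝ := ![(-1, 0), (-1.5, 0.5), (-1, 1), (-0.5, 0.5)]

/-- The four points of the second cluster of `Y_k`. -/
def Ybase2 : Fin 4 → ℝ × ℝ := ![(1, 0), (0.5, 0.5), (1, 1), (1.5, 0.5)]

/-- `Ypt i a = p_i^{a+1}`, the `a`-th point of the `i`-th cluster of `Y_k`. -/
def Ypt : ℕ → Fin 4 → ℝ × ℝ
  | 0, _ => (0, 0)
  | 1, a => Ybase1 a
  | 2, a => Ybase2 a
  | 3, a => Ybase1 a + (1, 2)
  | 4, a => Ybase2 a + (2, 1)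
  | i + 5, a => Ypt (i + 3) a + (2, 2)

/-- The cluster `C_i = {p_i^1, p_i^2, p_i^3, p_i^4}` of `Y_k`. -/
def Ycluster (i : ℕ) : Multiset (EuclideanSpace ℝ (Fin 2)) :=
  (Finset.univ : Finset (Fin 4)).val.map fun a => toE2 (Ypt i a)

/-- The partition `C = (C_1, …, C_k)` of `Y_k`. -/
def Ypartition (k : ℕ) : Multiset (Multiset (EuclideanSpace ℝ (Fin 2))) :=
  (Finset.range k).val.map fun i => Ycluster (i + 1)

/-- The point-set `Y_k` (as a multiset of `4k` points in the plane). -/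
def Yset (k : ℕ) : Multiset (EuclideanSpace ℝ (Fin 2)) := (Ypartition k).sum

/-- A partition of `∑ q, B q`, for pairwise disjoint nonempty `B q`, into at most as many
clusters as there are blocks, each contained in a block, consists of the blocks. -/
lemma eq_map_blocks_of_subordinate {α ι : Type*} [Fintype ι] [Nonempty ι] (B : ι → Multiset α)
    (hdisj : ∀ q q' x, x ∈ B q → x ∈ B q' → q = q') (hne : ∀ q, ∃ x, x ∈ B q)
    (P : Multiset (Multiset α)) (hsum : P.sum = ∑ q, B q)
    (hcard : Multiset.card P ≤ Fintype.card ι)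
    (hsub : ∀ S ∈ P, ∃ q, ∀ x ∈ S, x ∈ B q) :
    P = (Finset.univ : Finset ι).val.map B := by
  choose! g hg using hsub
  have hmemX : ∀ x, (∃ S ∈ P, x ∈ S) ↔ ∃ q, x ∈ B q := by
    intro x
    have h1 : x ∈ P.sum ↔ ∃ S ∈ P, x ∈ S := Multiset.mem_join
    rw [← h1, hsum, Multiset.mem_sum]
    simp
  have huniv : (Finset.univ : Finset ι).val = P.map g := by
    refine Multiset.eq_of_le_of_card_le ?_ (by simpa using hcard)
    rw [Multiset.le_iff_subset Finset.univ.nodup]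
    intro q _
    obtain ⟨x, hx⟩ := hne q
    obtain ⟨S, hS, hxS⟩ := (hmemX x).2 ⟨q, hx⟩
    exact Multiset.mem_map.2 ⟨S, hS, hdisj _ _ x (hg S hS x hxS) hx⟩
  have hblock : ∀ S ∈ P, B (g S) = S := by
    intro S hS
    refine Multiset.ext.2 fun x => ?_
    by_cases hx : x ∈ B (g S)
    · obtain ⟨P', rfl⟩ := Multiset.exists_cons_of_mem hS
      have hnotin : g S ∉ P'.map g := by
        have := huniv ▸ (Finset.univ : Finset ι).nodup
        rw [Multiset.map_cons, Multiset.nodup_cons] at this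
        exact this.1
      have hrest : Multiset.count x P'.sum = 0 := by
        refine Multiset.count_eq_zero.2 fun h => hnotin ?_
        obtain ⟨T, hT, hxT⟩ := Multiset.mem_join.1 (show x ∈ P'.join from h)
        exact Multiset.mem_map.2
          ⟨T, hT, hdisj _ _ x (hg T (Multiset.mem_cons_of_mem hT) x hxT) hx⟩
      have hcount := congrArg (Multiset.count x) hsum
      rw [Multiset.sum_cons, Multiset.count_add, hrest, add_zero, Multiset.count_sum',
        Finset.sum_eq_single (g S)] at hcount
      · exact hcount.symm
      · exact fun q _ hq => Multiset.count_eq_zero.2 fun h => hq (hdisj _ _ x h hx)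
      · simp
    · rw [Multiset.count_eq_zero.2 hx, Multiset.count_eq_zero.2 fun h => hx (hg S hS x h)]
  rw [huniv, Multiset.map_map]
  exact ((Multiset.map_congr rfl hblock).trans (Multiset.map_id' P)).symm

/-- Any two points of a cluster are at distance less than twice any strict upper bound
for the k-center cost. -/
lemma norm_sub_lt_of_costCenter_lt {d : ℕ} {P : Multiset (Multiset (EuclideanSpace ℝ (Fin d)))}
    {r : ℝ} (h : costCenter P < r) {S : Multiset (EuclideanSpace ℝ (Fin d))} (hS : S ∈ P)
    {x y : EuclideanSpace ℝ (Fin d)} (hx : x ∈ S) (hy : y ∈ S) : ‖x - y‖ < 2 * r := by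
  have h1 : costCenter1 S < r := by
    refine lt_of_le_of_lt (le_csSup ?_ (Set.mem_image_of_mem costCenter1 hS)) h
    exact (Set.Finite.image _ (Multiset.finite_toSet P)).bddAbove
  obtain ⟨c, hc⟩ := exists_lt_of_ciInf_lt h1
  have h2 : ∀ z ∈ S, ‖z - c‖ < r := fun z hz => by
    refine lt_of_le_of_lt (le_csSup ?_ (Set.mem_image_of_mem (fun x => ‖x - c‖) hz)) hc
    exact (Set.Finite.image _ (Multiset.finite_toSet S)).bddAbove
  have h3 : ‖x - y‖ ≤ ‖x - c‖ + ‖y - c‖ := by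
    have := norm_sub_le (x - c) (y - c)
    simpa using this
  linarith [h2 x hx, h2 y hy]

lemma mem_epsBall {n d : ℕ} (hn : 1 ≤ n) {ε : ℝ} {i : Fin d} {a : Bool}
    {x : EuclideanSpace ℝ (Fin d)} :
    x ∈ epsBall n d ε i a ↔ ∃ j b, x = hdPoint d ε i j a b := by
  have : n ≠ 0 := by omega
  simp [epsBall, Multiset.mem_replicate, this]

lemma norm_sub_center_of_mem_epsBall {n d : ℕ} (hn : 1 ≤ n) {ε : ℝ} (hε : 0 < ε) {i : Fin d}
    {a : Bool} {x : EuclideanSpace ℝ (Fin d)} (hx : x ∈ epsBall n d ε i a) :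
    ‖x - EuclideanSpace.single i (sgn a)‖ = ε := by
  obtain ⟨j, b, rfl⟩ := (mem_epsBall hn).1 hx
  have : |sgn b| = 1 := by cases b <;> simp [sgn]
  simp [hdPoint, this, abs_of_pos hε]

lemma one_le_norm_center_sub {d : ℕ} {q q' : Fin d × Bool} (h : q ≠ q') :
    1 ≤ ‖EuclideanSpace.single q.1 (sgn q.2) - EuclideanSpace.single q'.1 (sgn q'.2)‖ := by
  refine le_trans ?_ (PiLp.norm_apply_le _ q.1)
  obtain ⟨i, a⟩ := q
  obtain ⟨i', a'⟩ := q'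
  by_cases hi : i = i'
  · subst hi
    cases a <;> cases a' <;> simp_all [sgn] <;> norm_num
  · cases a <;> simp [hi, sgn]

lemma epsBall_index_eq {n d : ℕ} (hn : 1 ≤ n) {ε : ℝ} (hε : 0 < ε) {q q' : Fin d × Bool}
    {x y : EuclideanSpace ℝ (Fin d)} (hx : x ∈ epsBall n d ε q.1 q.2)
    (hy : y ∈ epsBall n d ε q'.1 q'.2) (hxy : ‖x - y‖ + 2 * ε < 1) : q = q' := by
  by_contra h
  have h1 := one_le_norm_center_sub h
  have h2 := norm_sub_center_of_mem_epsBall hn hε hx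
  have h3 := norm_sub_center_of_mem_epsBall hn hε hy
  set u := EuclideanSpace.single q.1 (sgn q.2)
  set v := EuclideanSpace.single q'.1 (sgn q'.2)
  have h4 : u - v = (x - y) - (x - u) + (y - v) := by abel
  have h5 := norm_add_le ((x - y) - (x - u)) (y - v)
  have h6 := norm_sub_le (x - y) (x - u)
  rw [← h4] at h5
  linarith

lemma costCenter1_epsBall {n d : ℕ} (hn : 1 ≤ n) {ε : ℝ} (hε : 0 < ε) (i : Fin d) (a : Bool) :
    costCenter1 (epsBall n d ε i a) = ε := by
  have hbdd : ∀ c : EuclideanSpace ℝ (Fin d),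
      BddAbove ((fun x => ‖x - c‖) '' {x | x ∈ epsBall n d ε i a}) := fun c =>
    (Set.Finite.image _ (Multiset.finite_toSet _)).bddAbove
  have hmem : ∀ b, hdPoint d ε i i a b ∈ epsBall n d ε i a := fun b =>
    (mem_epsBall hn).2 ⟨i, b, rfl⟩
  have hlow : ∀ c : EuclideanSpace ℝ (Fin d),
      ε ≤ sSup ((fun x => ‖x - c‖) '' {x | x ∈ epsBall n d ε i a}) := by
    intro c
    have h1 := le_csSup (hbdd c) ⟨_, hmem true, rfl⟩
    have h2 := le_csSup (hbdd c) ⟨_, hmem false, rfl⟩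
    have h3 := norm_sub_le (hdPoint d ε i i a true - c) (hdPoint d ε i i a false - c)
    have h4 : ‖(hdPoint d ε i i a true - c) - (hdPoint d ε i i a false - c)‖ = 2 * ε := by
      have : (hdPoint d ε i i a true - c) - (hdPoint d ε i i a false - c)
          = EuclideanSpace.single i (2 * ε) := by
        ext j
        by_cases hj : j = i <;> simp [hdPoint, sgn, hj]
        ring
      rw [this, PiLp.norm_single, Real.norm_eq_abs, abs_of_pos (by linarith)]
    simp only at h1 h2
    linarith
  refine le_antisymm ?_ (le_ciInf hlow)
  refine (ciInf_le ⟨ε, ?_⟩ (EuclideanSpace.single i (sgn a))).trans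
    (csSup_le ⟨_, _, hmem true, rfl⟩ ?_)
  · rintro _ ⟨c, rfl⟩
    exact hlow c
  · rintro _ ⟨x, hx, rfl⟩
    exact (norm_sub_center_of_mem_epsBall hn hε hx).le

lemma costCenter_XhdPartition {n d : ℕ} (hd : 0 < d) (hn : 1 ≤ n) {ε : ℝ} (hε : 0 < ε) :
    costCenter (XhdPartition n d ε) = ε := by
  have : costCenter1 '' {C | C ∈ XhdPartition n d ε} = {ε} := by
    refine Set.eq_singleton_iff_nonempty_unique_mem.2 ⟨⟨_, epsBall n d ε ⟨0, hd⟩ true, ?_, rfl⟩, ?_⟩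
    · exact Multiset.mem_map.2 ⟨(⟨0, hd⟩, true), Finset.mem_univ _, rfl⟩
    · rintro _ ⟨S, hS, rfl⟩
      obtain ⟨q, -, rfl⟩ := Multiset.mem_map.1 hS
      exact costCenter1_epsBall hn hε _ _
  rw [costCenter, this, csSup_singleton]

lemma exists_mem_epsBall {n d : ℕ} (hn : 1 ≤ n) (ε : ℝ) (q : Fin d × Bool) :
    ∃ x, x ∈ epsBall n d ε q.1 q.2 :=
  ⟨_, (mem_epsBall hn).2 ⟨q.1, q.2, rfl⟩⟩

lemma isClustering_XhdPartition {n d : ℕ} (hn : 1 ≤ n) (ε : ℝ) :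
    IsClustering (Xhd n d ε) (2 * d) (XhdPartition n d ε) := by
  refine ⟨rfl, ?_, fun h => ?_⟩
  · simp [XhdPartition, mul_comm]
  · obtain ⟨q, -, hq⟩ := Multiset.mem_map.1 h
    obtain ⟨x, hx⟩ := exists_mem_epsBall hn ε q
    simp [hq] at hx

lemma le_costCenter_of_ne_XhdPartition {n d : ℕ} (hd : 0 < d) (hn : 1 ≤ n) {ε M : ℝ} (hε : 0 < ε)
    (hM : 1 ≤ M) (hεM : 4 * M * ε < 1)
    {P : Multiset (Multiset (EuclideanSpace ℝ (Fin d)))}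
    (hP : IsClustering (Xhd n d ε) (2 * d) P) (hne : P ≠ XhdPartition n d ε) :
    M * ε ≤ costCenter P := by
  by_contra! hlt
  have : Nonempty (Fin d × Bool) := ⟨⟨0, hd⟩, true⟩
  have hεM' : ε ≤ M * ε := le_mul_of_one_le_left hε.le hM
  obtain ⟨hsum, hcard, h0⟩ := hP
  refine hne (eq_map_blocks_of_subordinate (fun q : Fin d × Bool => epsBall n d ε q.1 q.2)
    (fun q q' x hx hx' => epsBall_index_eq hn hε hx hx' (by simp; linarith))
    (exists_mem_epsBall hn ε) P hsum (by simpa [mul_comm] using hcard) fun S hS => ?_)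
  have hX : ∀ x ∈ S, ∃ q : Fin d × Bool, x ∈ epsBall n d ε q.1 q.2 := by
    intro x hx
    have hxX : x ∈ Xhd n d ε := hsum ▸ Multiset.mem_join.2 ⟨S, hS, hx⟩
    obtain ⟨T, hT, hxT⟩ := Multiset.mem_join.1 (show x ∈ (XhdPartition n d ε).join from hxX)
    obtain ⟨q, -, rfl⟩ := Multiset.mem_map.1 hT
    exact ⟨q, hxT⟩
  obtain ⟨y, hy⟩ := Multiset.exists_mem_of_ne_zero (fun h => h0 (h ▸ hS) : S ≠ 0)
  obtain ⟨q, hq⟩ := hX y hy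
  refine ⟨q, fun x hx => ?_⟩
  obtain ⟨q', hq'⟩ := hX x hx
  have := norm_sub_lt_of_costCenter_lt hlt hS hx hy
  rwa [← epsBall_index_eq hn hε hq' hq (by linarith)]

/-- STATEMENT: optimality of the ε-ball partition of `X(n, ε, d)` and the cost of any
other partition, for the k-center objective (`k = 2d`). -/
theorem stmt_5 (d n : ℕ) (hd : 2 ≤ d) (hn : 1 ≤ n) (p : ℕ → ℕ) :
    ∃ ε₀ : ℝ, 0 < ε₀ ∧ ∀ ε : ℝ, 0 < ε → ε < ε₀ →
      costCenter (XhdPartition n d ε) = ε ∧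
      optCenter (Xhd n d ε) (2 * d) = costCenter (XhdPartition n d ε) ∧
      ∀ P, IsClustering (Xhd n d ε) (2 * d) P → P ≠ XhdPartition n d ε →
        (p (4 * n * d ^ 2) : ℝ) * costCenter (XhdPartition n d ε) ≤ costCenter P := by
  set M : ℝ := (p (4 * n * d ^ 2) : ℝ) + 1
  have hM : 1 ≤ M := by simp [M]
  refine ⟨1 / (4 * M), by positivity, fun ε hε hlt => ?_⟩
  have hεM : 4 * M * ε < 1 := by
    rw [lt_div_iff₀ (by positivity)] at hlt
    linarith
  have hC := costCenter_XhdPartition (n := n) (d := d) (by omega) hn hε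
  have key := fun P hP hne =>
    le_costCenter_of_ne_XhdPartition (d := d) (P := P) (by omega) hn hε hM hεM hP hne
  refine ⟨hC, IsLeast.csInf_eq ⟨⟨_, isClustering_XhdPartition hn ε, rfl⟩, ?_⟩, ?_⟩
  · rintro _ ⟨P, hP, rfl⟩
    by_cases hne : P = XhdPartition n d ε
    · rw [hne]
    · rw [hC]
      exact (le_mul_of_one_le_left hε.le hM).trans (key P hP hne)
  · intro P hP hne
    rw [hC]
    have h1 := key P hP hne
    have h2 : M * ε = p (4 * n * d ^ 2) * ε + ε := by ring
    linarith

end
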